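/- Let X_1,...,X_d (d ≥ 2) and Y be discrete random variables with values in finite sets, jointly distributed with strictly positive pmf P. Then the weight of the Naive Bayes approximation is at most the weight of the chain Generalized Naive Bayes approximation: Σ_{i=1}^d I(X_i; Y) ≤ Σ_{i=1}^{d−1} I(Y, X_i, X_{i+1}) − Σ_{i=2}^{d−1} I(Y, X_i). -/

import Mathlib

open scoped Classical BigOperators
open Real

noncomputable section

namespace GNB

variable {d : ℕ} {α : Fin d → Type} {β : Type} [∀ i, Fintype (α i)] [Fintype β]

/-- A joint configuration of the explanatory variables `X i` and the class variable `Y`. -/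
abbrev Cfg (α : Fin d → Type) (β : Type) := ((i : Fin d) → α i) × β

/-- Marginal pmf of the class variable `Y`. -/
def margY (P : Cfg α β → ℝ) (y : β) : ℝ := ∑ x : (i : Fin d) → α i, P (x, y)

/-- Marginal pmf of the variable `X i`. -/
def margX (P : Cfg α β → ℝ) (i : Fin d) (a : α i) : ℝ :=
  ∑ z : Cfg α β, if z.1 i = a then P z else 0

/-- Marginal pmf of the pair `(X i, Y)`. -/
def margXY (P : Cfg α β → ℝ) (i : Fin d) (a : α i) (y : β) : ℝ :=
  ∑ x : (i : Fin d) → α i, if x i = a then P (x, y) else 0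

/-- Marginal pmf of the triplet `(X i, X j, Y)`. -/
def margXXY (P : Cfg α β → ℝ) (i j : Fin d) (a : α i) (b : α j) (y : β) : ℝ :=
  ∑ x : (i : Fin d) → α i, if x i = a ∧ x j = b then P (x, y) else 0

/-- Joint entropy `H(X_1,…,X_d,Y)`. -/
def HJoint (P : Cfg α β → ℝ) : ℝ := -∑ z : Cfg α β, P z * Real.log (P z)

/-- Entropy `H(Y)`. -/
def HY (P : Cfg α β → ℝ) : ℝ := -∑ y : β, margY P y * Real.log (margY P y)

/-- Entropy `H(X i)`. -/
def HX (P : Cfg α β → ℝ) (i : Fin d) : ℝ :=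
  -∑ a : α i, margX P i a * Real.log (margX P i a)

/-- Entropy `H(Y, X i)`. -/
def HYX (P : Cfg α β → ℝ) (i : Fin d) : ℝ :=
  -∑ y : β, ∑ a : α i, margXY P i a y * Real.log (margXY P i a y)

/-- Entropy `H(Y, X i, X j)`. -/
def HYXX (P : Cfg α β → ℝ) (i j : Fin d) : ℝ :=
  -∑ y : β, ∑ a : α i, ∑ b : α j, margXXY P i j a b y * Real.log (margXXY P i j a b y)

/-- Mutual information `I(X i ; Y)`. -/
def IY2 (P : Cfg α β → ℝ) (i : Fin d) : ℝ :=
  ∑ y : β, ∑ a : α i, margXY P i a y *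
    Real.log (margXY P i a y / (margX P i a * margY P y))

/-- Information content `I(Y, X i, X j)`. -/
def IY3 (P : Cfg α β → ℝ) (i j : Fin d) : ℝ :=
  ∑ y : β, ∑ a : α i, ∑ b : α j, margXXY P i j a b y *
    Real.log (margXXY P i j a b y / (margY P y * margX P i a * margX P j b))

/-- Kullback–Leibler divergence `KL(p ‖ q)`. -/
def KL {γ : Type} [Fintype γ] (p q : γ → ℝ) : ℝ := ∑ c : γ, p c * Real.log (p c / q c)

/-- The Naive Bayes approximation `P_NB(x,y) = P(y) ∏ i, P(x i | y)`. -/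
def PNB (P : Cfg α β → ℝ) : Cfg α β → ℝ :=
  fun z => margY P z.2 * ∏ i : Fin d, (margXY P i (z.1 i) z.2 / margY P z.2)

/-- The Generalized Naive Bayes approximation determined by the mother function `μ`:
`P_GNB(x,y) = (∏_{i=2}^d P(y, x_{μ i}, x_i)) / (∏_{i=3}^d P(y, x_{μ i}))`
(indices are `0`-based: variable `X_k` of the paper is `X (k-1)` here). -/
def PGNB (P : Cfg α β → ℝ) (μ : Fin d → Fin d) : Cfg α β → ℝ :=
  fun z =>
    (∏ i ∈ Finset.univ.filter (fun i : Fin d => 1 ≤ (i : ℕ)),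
        margXXY P (μ i) i (z.1 (μ i)) (z.1 i) z.2) /
    (∏ i ∈ Finset.univ.filter (fun i : Fin d => 2 ≤ (i : ℕ)),
        margXY P (μ i) (z.1 (μ i)) z.2)

/-- Predecessor on `Fin d` (truncated at `0`). -/
def pred (i : Fin d) : Fin d := ⟨(i : ℕ) - 1, lt_of_le_of_lt (Nat.sub_le _ _) i.isLt⟩

end GNB

namespace GNB

variable {d : ℕ} {α : Fin d → Type} {β : Type} [∀ i, Fintype (α i)]

lemma sum_margXY (P : Cfg α β → ℝ) (i : Fin d) (y : β) :
    ∑ a, margXY P i a y = margY P y := by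
  simp only [margXY, margY]
  rw [Finset.sum_comm]
  simp

lemma sum_margXXY_right (P : Cfg α β → ℝ) (i j : Fin d) (a : α i) (y : β) :
    ∑ b, margXXY P i j a b y = margXY P i a y := by
  simp only [margXXY, margXY, ite_and]
  rw [Finset.sum_comm]
  refine Finset.sum_congr rfl fun x _ => ?_
  split_ifs <;> simp

lemma sum_margXXY_left (P : Cfg α β → ℝ) (i j : Fin d) (b : α j) (y : β) :
    ∑ a, margXXY P i j a b y = margXY P j b y := by
  simp only [margXXY, margXY, ite_and]
  rw [Finset.sum_comm]
  simp

lemma margY_pos [∀ i, Nonempty (α i)] {P : Cfg α β → ℝ} (hpos : ∀ z, 0 < P z) (y : β) :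
    0 < margY P y :=
  Finset.sum_pos (fun _ _ => hpos _) Finset.univ_nonempty

lemma margXY_pos [∀ i, Nonempty (α i)] {P : Cfg α β → ℝ} (hpos : ∀ z, 0 < P z)
    (i : Fin d) (a : α i) (y : β) : 0 < margXY P i a y := by
  refine Finset.sum_pos' (fun x _ => ?_)
    ⟨Function.update (fun k => Classical.arbitrary (α k)) i a, Finset.mem_univ _, ?_⟩
  · split_ifs
    exacts [(hpos _).le, le_rfl]
  · simpa using hpos _

lemma margX_pos [∀ i, Nonempty (α i)] [Fintype β] [Nonempty β] {P : Cfg α β → ℝ}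
    (hpos : ∀ z, 0 < P z) (i : Fin d) (a : α i) : 0 < margX P i a := by
  refine Finset.sum_pos' (fun x _ => ?_)
    ⟨(Function.update (fun k => Classical.arbitrary (α k)) i a, Classical.arbitrary β),
      Finset.mem_univ _, ?_⟩
  · split_ifs
    exacts [(hpos _).le, le_rfl]
  · simpa using hpos _

lemma margXXY_nonneg {P : Cfg α β → ℝ} (hpos : ∀ z, 0 < P z)
    (i j : Fin d) (a : α i) (b : α j) (y : β) : 0 ≤ margXXY P i j a b y := by
  refine Finset.sum_nonneg fun x _ => ?_
  split_ifs
  exacts [(hpos _).le, le_rfl]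

/-- Pointwise form of the nonnegativity of conditional mutual information. -/
lemma mul_log_add_mul_log_add_sub_le {p A B c a b : ℝ} (hp : 0 ≤ p) (hA : 0 < A) (hB : 0 < B)
    (hc : 0 < c) (ha : 0 < a) (hb : 0 < b) :
    p * Real.log (A / (a * c)) + p * Real.log (B / (b * c)) + (p - A * B / c) ≤
      p * Real.log (p / (c * a * b)) := by
  rcases hp.eq_or_lt with rfl | hp
  · simp only [zero_mul, zero_add, zero_sub, neg_nonpos]
    positivity
  · have key := Real.log_le_sub_one_of_pos (show 0 < A * B / c / p by positivity)
    have hlog : Real.log (A * B / c / p) = Real.log (A / (a * c)) + Real.log (B / (b * c))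
        - Real.log (p / (c * a * b)) := by
      rw [← Real.log_mul (by positivity) (by positivity),
        ← Real.log_div (by positivity) (by positivity)]
      congr 1
      field_simp
    have hmul := mul_le_mul_of_nonneg_left key hp.le
    rw [hlog, mul_sub p _ 1, mul_div_cancel₀ _ hp.ne'] at hmul
    linarith

lemma IY2_add_IY2_le_IY3 [∀ i, Nonempty (α i)] [Fintype β] [Nonempty β]
    {P : Cfg α β → ℝ} (hpos : ∀ z, 0 < P z) (i j : Fin d) :
    IY2 P i + IY2 P j ≤ IY3 P i j := by
  simp only [IY2, IY3, ← Finset.sum_add_distrib]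
  refine Finset.sum_le_sum fun y _ => ?_
  have hi : ∑ a, margXY P i a y * Real.log (margXY P i a y / (margX P i a * margY P y)) =
      ∑ a, ∑ b, margXXY P i j a b y *
        Real.log (margXY P i a y / (margX P i a * margY P y)) := by
    simp only [← Finset.sum_mul, sum_margXXY_right]
  have hj : ∑ b, margXY P j b y * Real.log (margXY P j b y / (margX P j b * margY P y)) =
      ∑ a, ∑ b, margXXY P i j a b y *
        Real.log (margXY P j b y / (margX P j b * margY P y)) := by
    rw [Finset.sum_comm]
    simp only [← Finset.sum_mul, sum_margXXY_left]
  have hcorr : ∑ a, ∑ b,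
      (margXXY P i j a b y - margXY P i a y * margXY P j b y / margY P y) = 0 := by
    simp only [Finset.sum_sub_distrib, sum_margXXY_right, sum_margXY, ← Finset.sum_div,
      ← Finset.mul_sum, ← Finset.sum_mul]
    rw [mul_div_cancel_right₀ _ (margY_pos hpos y).ne', sub_self]
  rw [hi, hj, ← add_zero (_ + _), ← hcorr]
  simp only [← Finset.sum_add_distrib]
  exact Finset.sum_le_sum fun a _ => Finset.sum_le_sum fun b _ =>
    mul_log_add_mul_log_add_sub_le (margXXY_nonneg hpos i j a b y) (margXY_pos hpos i a y)
      (margXY_pos hpos j b y) (margY_pos hpos y) (margX_pos hpos i a) (margX_pos hpos j b)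

end GNB

/-- The weight of the Naive Bayes approximation is at most the
weight of the chain Generalized Naive Bayes approximation:
`Σ_{i=1}^d I(Xᵢ;Y) ≤ Σ_{i=1}^{d−1} I(Y,Xᵢ,Xᵢ₊₁) − Σ_{i=2}^{d−1} I(Y,Xᵢ)`
(indices are `0`-based; the right-hand sums are reindexed by `k = i+1`). -/
theorem nb_weight_le_chain_gnb_weight (d : ℕ) (hd : 2 ≤ d) (α : Fin d → Type) (β : Type)
    [∀ i, Fintype (α i)] [∀ i, Nonempty (α i)] [Fintype β] [Nonempty β]
    (P : GNB.Cfg α β → ℝ) (hpos : ∀ z, 0 < P z) (hsum : ∑ z, P z = 1) :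
    ∑ i, GNB.IY2 P i ≤
      (∑ i ∈ Finset.univ.filter (fun i : Fin d => 1 ≤ (i : ℕ)), GNB.IY3 P (GNB.pred i) i)
        - ∑ i ∈ Finset.univ.filter (fun i : Fin d => 2 ≤ (i : ℕ)), GNB.IY2 P (GNB.pred i) := by
  obtain ⟨n, rfl⟩ : ∃ n, d = n + 2 := ⟨d - 2, by lia⟩
  have hone : Finset.univ.filter (fun i : Fin (n + 2) => 1 ≤ (i : ℕ)) =
      insert 1 (Finset.univ.filter fun i : Fin (n + 2) => 2 ≤ (i : ℕ)) := by
    ext i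
    simp only [Finset.mem_insert, Finset.mem_filter, Finset.mem_univ, true_and, Fin.ext_iff,
      Fin.val_one]
    lia
  have huniv : (Finset.univ : Finset (Fin (n + 2))) =
      insert 0 (Finset.univ.filter fun i : Fin (n + 2) => 1 ≤ (i : ℕ)) := by
    ext i
    simp only [Finset.mem_univ, Finset.mem_insert, Finset.mem_filter, true_and, Fin.ext_iff,
      Fin.val_zero]
    lia
  have hpred : GNB.pred (1 : Fin (n + 2)) = 0 := by
    simp [GNB.pred]
  have hle := Finset.sum_le_sum
    (s := Finset.univ.filter fun i : Fin (n + 2) => 1 ≤ (i : ℕ))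
    fun i _ => GNB.IY2_add_IY2_le_IY3 hpos (GNB.pred i) i
  have hsplit : ∑ i, GNB.IY2 P i = GNB.IY2 P 0 +
      ∑ i ∈ Finset.univ.filter (fun i : Fin (n + 2) => 1 ≤ (i : ℕ)), GNB.IY2 P i := by
    rw [← Finset.sum_insert (by simp), ← huniv]
  have hsplit_pred :
      ∑ i ∈ Finset.univ.filter (fun i : Fin (n + 2) => 1 ≤ (i : ℕ)), GNB.IY2 P (GNB.pred i) =
        GNB.IY2 P 0 + ∑ i ∈ Finset.univ.filter (fun i : Fin (n + 2) => 2 ≤ (i : ℕ)),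
          GNB.IY2 P (GNB.pred i) := by
    rw [hone, Finset.sum_insert (by simp), hpred]
  rw [Finset.sum_add_distrib] at hle
  linarith
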